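/- arXiv:1702.06997 — 3 statements merged into one kernel-verified Lean document; each statement's English description precedes it below -/
import Mathlib

section
/- For all naturals n, s, N, terms T : Fin N → (Fin s → Fin n), clauses C : Fin N → Fin N → (Fin s → Fin n), and strings x, y with x k = true implying y k = true for every coordinate k: (a) if Γ_{T,C}(x) = 1* then Γ_{T,C}(y) = 1*; and (b) if Γ_{T,C}(x) = (i, j) for some indices i, j, then either Γ_{T,C}(y) = 1* or Γ_{T,C}(y) = (i, j). -/
open scoped Classical

/-- `x` satisfies the term `T` if all variables of `T` are true in `x`. -/
def Satisfies {n s : ℕ} (x : Fin n → Bool) (T : Fin s → Fin n) : Prop :=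
  ∀ m, x (T m) = true

/-- `x` falsifies the clause `Cl` if all variables of `Cl` are false in `x`. -/
def Falsifies {n s : ℕ} (x : Fin n → Bool) (Cl : Fin s → Fin n) : Prop :=
  ∀ m, x (Cl m) = false

/-- `x` with coordinate `k` flipped. -/
def flipCoord {n : ℕ} (x : Fin n → Bool) (k : Fin n) : Fin n → Bool :=
  Function.update x k (!x k)

/-- The number of true coordinates of `x`. -/
def weight {n : ℕ} (x : Fin n → Bool) : ℕ :=
  (Finset.univ.filter fun k => x k = true).card

/-- The multiplexer map `Γ_{T,C}`; `Sum.inr false` is `0*`, `Sum.inr true` is `1*`. -/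
noncomputable def Gamma {n s N : ℕ} (T : Fin N → Fin s → Fin n)
    (C : Fin N → Fin N → Fin s → Fin n) (x : Fin n → Bool) :
    (Fin N × Fin N) ⊕ Bool :=
  if h1 : ∃! i, Satisfies x (T i) then
    if h2 : ∃! j, Falsifies x (C (Classical.choose h1) j) then
      Sum.inl (Classical.choose h1, Classical.choose h2)
    else if ∃ j, Falsifies x (C (Classical.choose h1) j) then Sum.inr false
    else Sum.inr true
  else if ∃ i, Satisfies x (T i) then Sum.inr true
  else Sum.inr false

/-- The function `f_{T,C,h}`. -/
noncomputable def fTCH {n s N : ℕ} (T : Fin N → Fin s → Fin n)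
    (C : Fin N → Fin N → Fin s → Fin n)
    (h : Fin N → Fin N → (Fin n → Bool) → Bool) (x : Fin n → Bool) : Bool :=
  if ((n : ℝ) / 2 + s) < (weight x : ℝ) then true
  else if ((weight x : ℝ)) < ((n : ℝ) / 2 - s) then false
  else
    match Gamma T C x with
    | Sum.inl (i, j) => h i j x
    | Sum.inr b => b

lemma Satisfies.mono {n s : ℕ} {x y : Fin n → Bool} {T : Fin s → Fin n}
    (hxy : ∀ k, x k = true → y k = true) (hx : Satisfies x T) : Satisfies y T :=
  fun m => hxy _ (hx m)

lemma Falsifies.anti {n s : ℕ} {x y : Fin n → Bool} {Cl : Fin s → Fin n}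
    (hxy : ∀ k, x k = true → y k = true) (hy : Falsifies y Cl) : Falsifies x Cl := by
  intro m
  by_contra hm
  simpa [hy m] using hxy (Cl m) (by simpa using hm)

section Gamma

variable {n s N : ℕ} {T : Fin N → Fin s → Fin n} {C : Fin N → Fin N → Fin s → Fin n}
  {x : Fin n → Bool} {i j : Fin N}

lemma Gamma_eq_inr_true_of_ne {i' : Fin N} (hi : Satisfies x (T i)) (hi' : Satisfies x (T i'))
    (hne : i ≠ i') : Gamma T C x = Sum.inr true := by
  have hnot : ¬ ∃! i, Satisfies x (T i) := fun h => hne (h.unique hi hi')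
  rw [Gamma, dif_neg hnot, if_pos ⟨i, hi⟩]

lemma Gamma_of_unique (hi : Satisfies x (T i)) (huniq : ∀ i', Satisfies x (T i') → i' = i) :
    Gamma T C x =
      if h : ∃! j, Falsifies x (C i j) then Sum.inl (i, Classical.choose h)
      else if ∃ j, Falsifies x (C i j) then Sum.inr false
      else Sum.inr true := by
  have h1 : ∃! i, Satisfies x (T i) := ⟨i, hi, huniq⟩
  obtain rfl : Classical.choose h1 = i := huniq _ (Classical.choose_spec h1).1
  rw [Gamma, dif_pos h1]

lemma Gamma_eq_inr_true_of_forall_not_falsifies (hi : Satisfies x (T i))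
    (hC : ∀ j, ¬ Falsifies x (C i j)) : Gamma T C x = Sum.inr true := by
  by_cases huniq : ∀ i', Satisfies x (T i') → i' = i
  · rw [Gamma_of_unique hi huniq, dif_neg fun h => hC _ h.exists.choose_spec,
      if_neg (not_exists.2 hC)]
  · push Not at huniq
    obtain ⟨i', hi', hne⟩ := huniq
    exact Gamma_eq_inr_true_of_ne hi' hi hne

lemma Gamma_eq_inl_of_unique (hi : Satisfies x (T i))
    (hiuniq : ∀ i', Satisfies x (T i') → i' = i) (hj : Falsifies x (C i j))
    (hjuniq : ∀ j', Falsifies x (C i j') → j' = j) : Gamma T C x = Sum.inl (i, j) := by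
  have h : ∃! j, Falsifies x (C i j) := ⟨j, hj, hjuniq⟩
  rw [Gamma_of_unique hi hiuniq, dif_pos h, hjuniq _ (Classical.choose_spec h).1]

lemma exists_of_Gamma_eq_inr_true (h : Gamma T C x = Sum.inr true) :
    (∃ i i', Satisfies x (T i) ∧ Satisfies x (T i') ∧ i ≠ i') ∨
      ∃ i, Satisfies x (T i) ∧ ∀ j, ¬ Falsifies x (C i j) := by
  by_cases h1 : ∃! i, Satisfies x (T i)
  · obtain ⟨i, hi, huniq⟩ := h1
    rw [Gamma_of_unique hi huniq] at h
    split_ifs at h with h2 h3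
    · simp at h
    · exact Or.inr ⟨i, hi, not_exists.1 h3⟩
  · rw [Gamma, dif_neg h1] at h
    split_ifs at h with h2
    · obtain ⟨i, hi⟩ := h2
      by_contra! hcon
      exact h1 ⟨i, hi, fun i' hi' => hcon.1 i' i hi' hi⟩
    · simp at h

lemma falsifies_of_Gamma_eq_inl (h : Gamma T C x = Sum.inl (i, j)) :
    Satisfies x (T i) ∧ Falsifies x (C i j) ∧ ∀ j', Falsifies x (C i j') → j' = j := by
  by_cases h1 : ∃! i, Satisfies x (T i)
  · obtain ⟨i₀, hi, huniq⟩ := h1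
    rw [Gamma_of_unique hi huniq] at h
    split_ifs at h with h2
    · simp only [Sum.inl.injEq, Prod.mk.injEq] at h
      obtain ⟨rfl, rfl⟩ := h
      exact ⟨hi, Classical.choose_spec h2⟩
  · rw [Gamma, dif_neg h1] at h
    split_ifs at h

end Gamma

/-- monotonicity properties of the multiplexer map. -/
theorem statement1 (n s N : ℕ) (T : Fin N → Fin s → Fin n)
    (C : Fin N → Fin N → Fin s → Fin n) (x y : Fin n → Bool)
    (hxy : ∀ k, x k = true → y k = true) :
    (Gamma T C x = Sum.inr true → Gamma T C y = Sum.inr true) ∧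
    (∀ i j : Fin N, Gamma T C x = Sum.inl (i, j) →
      Gamma T C y = Sum.inr true ∨ Gamma T C y = Sum.inl (i, j)) := by
  refine ⟨fun h => ?_, fun i j h => ?_⟩
  · rcases exists_of_Gamma_eq_inr_true h with ⟨i, i', hi, hi', hne⟩ | ⟨i, hi, hC⟩
    · exact Gamma_eq_inr_true_of_ne (hi.mono hxy) (hi'.mono hxy) hne
    · exact Gamma_eq_inr_true_of_forall_not_falsifies (hi.mono hxy)
        fun j hj => hC j (hj.anti hxy)
  · obtain ⟨hi, -, hjuniq⟩ := falsifies_of_Gamma_eq_inl h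
    by_cases huniq : ∀ i', Satisfies y (T i') → i' = i
    · by_cases hC : ∃ j', Falsifies y (C i j')
      · obtain ⟨j', hj'⟩ := hC
        obtain rfl := hjuniq j' (hj'.anti hxy)
        exact Or.inr (Gamma_eq_inl_of_unique (hi.mono hxy) huniq hj'
          fun k hk => hjuniq k (hk.anti hxy))
      · exact Or.inl (Gamma_eq_inr_true_of_forall_not_falsifies (hi.mono hxy)
          (not_exists.1 hC))
    · push Not at huniq
      obtain ⟨i', hi', hne⟩ := huniq
      exact Or.inl (Gamma_eq_inr_true_of_ne hi' (hi.mono hxy) hne)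
end

section
/- Fix naturals n, s, N with N ≥ 1, a string x : Fin n → Bool with exactly w coordinates equal to true, a coordinate k with x k = false, and an index i₀ : Fin N. Among all tuples T : Fin N → (Fin s → Fin n) (there are n^(s·N) of them), the number of tuples such that x satisfies T i₀ and, for every i ≠ i₀, the flipped string x^(k) does not satisfy T i, equals w^s · (n^s − (w + 1)^s)^(N − 1). -/
open scoped Classical

theorem card_filter_satisfies {n : ℕ} (s : ℕ) (x : Fin n → Bool) :
    (Finset.univ.filter fun T : Fin s → Fin n => Satisfies x T).card = weight x ^ s := by
  have h : (Finset.univ.filter fun T : Fin s → Fin n => Satisfies x T) =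
      Fintype.piFinset fun _ => Finset.univ.filter fun k => x k = true := by
    ext T
    simp only [Finset.mem_filter_univ, Fintype.mem_piFinset]
    exact Iff.rfl
  rw [h, Fintype.card_piFinset_const, weight]

theorem card_filter_not_satisfies {n : ℕ} (s : ℕ) (x : Fin n → Bool) :
    (Finset.univ.filter fun T : Fin s → Fin n => ¬ Satisfies x T).card =
      n ^ s - weight x ^ s := by
  rw [← card_filter_satisfies, ← Finset.compl_filter, Finset.card_compl]
  simp

theorem weight_flipCoord_of_eq_false {n : ℕ} {x : Fin n → Bool} {k : Fin n}
    (hk : x k = false) : weight (flipCoord x k) = weight x + 1 := by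
  have h : (Finset.univ.filter fun j => flipCoord x k j = true) =
      insert k (Finset.univ.filter fun j => x j = true) := by
    ext j
    simp only [Finset.mem_insert, Finset.mem_filter_univ]
    by_cases hj : j = k
    · subst hj
      simp [flipCoord, hk]
    · simp [flipCoord, hj]
  rw [weight, h, Finset.card_insert_of_notMem (by simp [hk]), weight]

/-- exact count of tuples of terms such that `x` satisfies `T i₀`
and `x^(k)` satisfies no other term. -/
theorem statement6 (n s N w : ℕ) (hN : 1 ≤ N) (x : Fin n → Bool)
    (hw : weight x = w) (k : Fin n) (hk : x k = false) (i₀ : Fin N) :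
    (Finset.univ.filter fun T : Fin N → Fin s → Fin n =>
        Satisfies x (T i₀) ∧ ∀ i : Fin N, i ≠ i₀ →
          ¬ Satisfies (flipCoord x k) (T i)).card
      = w ^ s * (n ^ s - (w + 1) ^ s) ^ (N - 1) := by
  have h : (Finset.univ.filter fun T : Fin N → Fin s → Fin n =>
        Satisfies x (T i₀) ∧ ∀ i : Fin N, i ≠ i₀ → ¬ Satisfies (flipCoord x k) (T i)) =
      Fintype.piFinset fun i =>
        if i = i₀ then Finset.univ.filter fun T => Satisfies x T
        else Finset.univ.filter fun T => ¬ Satisfies (flipCoord x k) T := by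
    ext T
    simp only [Finset.mem_filter_univ, Fintype.mem_piFinset]
    constructor
    · rintro ⟨h₀, h₁⟩ i
      by_cases hi : i = i₀
      · subst hi
        simpa using h₀
      · simpa [hi] using h₁ i hi
    · intro h
      refine ⟨by simpa using h i₀, fun i hi => ?_⟩
      simpa [hi] using h i
  rw [h, Fintype.card_piFinset, ← Finset.mul_prod_erase _ _ (Finset.mem_univ i₀), if_pos rfl,
    Finset.prod_congr rfl fun i hi => by rw [if_neg (Finset.ne_of_mem_erase hi)],
    Finset.prod_const, Finset.card_erase_of_mem (Finset.mem_univ i₀), Finset.card_fin,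
    card_filter_satisfies, card_filter_not_satisfies, weight_flipCoord_of_eq_false hk, hw]
end

section
/- There exist a real constant c > 0 and a natural s₀ such that for all naturals s ≥ s₀, setting n = s² and N = 2^s, for every natural w with (over ℝ) n/2 − s ≤ w ≤ n/2 + s: ((n − w − 1)/n)^s · (1 − ((n − w)/n)^s)^(N − 1) ≥ c/N. -/
theorem exp_neg_two_mul_le_one_sub {x : ℝ} (h0 : 0 ≤ x) (h1 : x ≤ 1 / 2) :
    Real.exp (-(2 * x)) ≤ 1 - x := by
  rw [Real.exp_neg]
  refine inv_le_of_inv_le₀ (by linarith) ?_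
  refine le_trans ?_ (Real.add_one_le_exp (2 * x))
  rw [inv_le_iff_one_le_mul₀ (by linarith)]
  nlinarith

theorem exp_neg_le_one_sub_div_pow {y : ℝ} {m : ℕ} (hm : 0 < m) (h0 : 0 ≤ y)
    (h1 : 2 * y ≤ m) : Real.exp (-(2 * y)) ≤ (1 - y / m) ^ m := by
  have hm' : (0 : ℝ) < m := by exact_mod_cast hm
  have h := exp_neg_two_mul_le_one_sub (x := y / m) (by positivity)
    (by rw [div_le_iff₀ hm']; linarith)
  refine le_trans (le_of_eq ?_) (pow_le_pow_left₀ (Real.exp_nonneg _) h m)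
  rw [← Real.exp_nat_mul]
  congr 1
  field_simp

/-- the probability that a fixed middle-layer string and its upward
neighbor uniquely falsify a given one of N random width-s clauses is Ω(1/N). -/
theorem statement9 : ∃ c : ℝ, 0 < c ∧ ∃ s₀ : ℕ, ∀ s : ℕ, s₀ ≤ s → ∀ w : ℕ,
    ((s : ℝ) ^ 2 / 2 - s ≤ (w : ℝ)) → ((w : ℝ) ≤ (s : ℝ) ^ 2 / 2 + s) →
    c / (2 ^ s : ℝ) ≤
      (((s : ℝ) ^ 2 - (w : ℝ) - 1) / (s : ℝ) ^ 2) ^ s *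
        (1 - (((s : ℝ) ^ 2 - (w : ℝ)) / (s : ℝ) ^ 2) ^ s) ^ (2 ^ s - 1) := by
  refine ⟨Real.exp (-(2 * 3)) * Real.exp (-(2 * 8)), by positivity, 6, ?_⟩
  intro s hs w hw₁ hw₂
  have hs6 : (6 : ℝ) ≤ s := by exact_mod_cast hs
  have hs0 : (0 : ℝ) < s := by linarith
  have hN : (64 : ℝ) ≤ 2 ^ s :=
    le_trans (by norm_num) (pow_le_pow_right₀ (by norm_num : (1 : ℝ) ≤ 2) hs)
  have hN0 : (0 : ℝ) < 2 ^ s := by positivity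
  have hlow : Real.exp (-(2 * 3)) / 2 ^ s ≤
      (((s : ℝ) ^ 2 - (w : ℝ) - 1) / (s : ℝ) ^ 2) ^ s := by
    have h3 : (0 : ℝ) ≤ 1 - 3 / s := by
      rw [sub_nonneg, div_le_one hs0]; linarith
    have h := exp_neg_le_one_sub_div_pow (y := 3) (m := s) (by omega) (by norm_num)
      (by linarith)
    calc Real.exp (-(2 * 3)) / 2 ^ s ≤ (1 - 3 / s) ^ s / 2 ^ s := by gcongr
      _ = ((1 - 3 / s) / 2) ^ s := by rw [div_pow]
      _ ≤ _ := by
        refine pow_le_pow_left₀ (by positivity) ?_ s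
        rw [le_div_iff₀ (by positivity)]
        have : (1 - 3 / (s : ℝ)) / 2 * (s : ℝ) ^ 2 = (s ^ 2 - 3 * s) / 2 := by
          field_simp
        rw [this]; linarith
  have hup : (((s : ℝ) ^ 2 - (w : ℝ)) / (s : ℝ) ^ 2) ^ s ≤ 8 / 2 ^ s := by
    have hexp : Real.exp 2 ≤ 8 := by
      have h1 := Real.exp_one_lt_d9
      have h2 : Real.exp 2 = Real.exp 1 * Real.exp 1 := by
        rw [← Real.exp_add]; norm_num
      nlinarith [Real.exp_pos 1]
    have hbase : ((s : ℝ) ^ 2 - (w : ℝ)) / (s : ℝ) ^ 2 ≤ Real.exp (2 / s) / 2 := by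
      have h1 := Real.add_one_le_exp (2 / (s : ℝ))
      have h2 : ((s : ℝ) ^ 2 - (w : ℝ)) / (s : ℝ) ^ 2 ≤ (2 / s + 1) / 2 := by
        rw [div_le_iff₀ (by positivity)]
        have : (2 / (s : ℝ) + 1) / 2 * (s : ℝ) ^ 2 = (s ^ 2 + 2 * s) / 2 := by
          field_simp
          ring
        rw [this]; linarith
      linarith
    have hnonneg : 0 ≤ ((s : ℝ) ^ 2 - (w : ℝ)) / (s : ℝ) ^ 2 :=
      div_nonneg (by nlinarith) (by positivity)
    calc _ ≤ (Real.exp (2 / s) / 2) ^ s := pow_le_pow_left₀ hnonneg hbase s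
      _ = Real.exp 2 / 2 ^ s := by
        rw [div_pow, ← Real.exp_nat_mul, mul_div_cancel₀ _ hs0.ne']
      _ ≤ 8 / 2 ^ s := by gcongr
  have h8 : (0 : ℝ) ≤ 1 - 8 / 2 ^ s := by
    rw [sub_nonneg, div_le_one hN0]; linarith
  have hmiss : Real.exp (-(2 * 8)) ≤
      (1 - (((s : ℝ) ^ 2 - (w : ℝ)) / (s : ℝ) ^ 2) ^ s) ^ (2 ^ s - 1) := by
    have h := exp_neg_le_one_sub_div_pow (y := 8) (m := 2 ^ s) (by positivity)
      (by norm_num) (by push_cast; linarith)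
    push_cast at h
    calc _ ≤ (1 - 8 / 2 ^ s : ℝ) ^ 2 ^ s := h
      _ ≤ (1 - 8 / 2 ^ s : ℝ) ^ (2 ^ s - 1) :=
        pow_le_pow_of_le_one h8 (sub_le_self _ (by positivity)) (Nat.sub_le _ _)
      _ ≤ _ := pow_le_pow_left₀ h8 (by linarith) _
  rw [mul_div_right_comm]
  exact mul_le_mul hlow hmiss (Real.exp_nonneg _) (le_trans (by positivity) hlow)
end
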